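/- Let d ≥ 2 and p > 1 with d < 2p/(p−1), set β₀ = (d(p−1) − 2p)/(p−1)², and let β : ℝ^d ∖ {0} → ℝ be continuous, bounded from above, with limsup_{x→0} |x|² β(x) < β₀. Then there exist l ∈ (0,1], γ > 0, R₀ > 1 and ε₀ ∈ (0,1) such that for all R ≥ R₀ and all ε ∈ (0, ε₀], the function ψ_{R,ε}(x,t) = ((|x| − ε)(R − |x|))^{−2/(p−1)} (1 + |x|)^{2/(p−1)} (1 + ε^l |x|^{−l} R^{2/(p−1)}) · exp(γ(t+1)), defined for ε < |x| < R and t ≥ 0, satisfies (1/2)Δψ_{R,ε} + β(x)ψ_{R,ε} − ψ_{R,ε}^p − ∂ψ_{R,ε}/∂t ≤ 0 for all x with ε < |x| < R and all t > 0. -/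

import Mathlib

open Set

/-- The `i`-th partial derivative of a function on `ℝ^d`. -/
noncomputable def pd {d : ℕ} (i : Fin d) (f : EuclideanSpace ℝ (Fin d) → ℝ)
    (x : EuclideanSpace ℝ (Fin d)) : ℝ :=
  fderiv ℝ f x (EuclideanSpace.single i 1)

/-- The supersolution
`ψ_{R,ε}(x,t) = ((|x|−ε)(R−|x|))^{−2/(p−1)} (1+|x|)^{2/(p−1)}
  (1 + ε^l |x|^{−l} R^{2/(p−1)}) exp(γ(t+1))`. -/
noncomputable def psiFun {d : ℕ} (p l γ R ε : ℝ)
    (x : EuclideanSpace ℝ (Fin d)) (t : ℝ) : ℝ :=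
  ((‖x‖ - ε) * (R - ‖x‖)) ^ (-2 / (p - 1)) * (1 + ‖x‖) ^ (2 / (p - 1)) *
    (1 + ε ^ l * ‖x‖ ^ (-l) * R ^ (2 / (p - 1))) * Real.exp (γ * (t + 1))

lemma hasFDerivAt_comp_norm {E : Type*} [NormedAddCommGroup E] [InnerProductSpace ℝ E]
    {g : ℝ → ℝ} {g' : ℝ} {x : E} (hx : x ≠ 0) (hg : HasDerivAt g g' ‖x‖) :
    HasFDerivAt (fun y => g ‖y‖) ((g' / ‖x‖) • innerSL ℝ x) x := by
  have hn : ‖x‖ ≠ 0 := norm_ne_zero_iff.2 hx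
  have h1 := ((hasStrictFDerivAt_norm_sq x).hasFDerivAt).sqrt (by positivity)
  simp only [Real.sqrt_sq (norm_nonneg _)] at h1
  refine (hg.comp_hasFDerivAt x h1).congr_fderiv ?_
  ext v
  simp
  ring

lemma pd_comp_norm {d : ℕ} (i : Fin d) {g : ℝ → ℝ} {g' : ℝ} {x : EuclideanSpace ℝ (Fin d)}
    (hx : x ≠ 0) (hg : HasDerivAt g g' ‖x‖) :
    pd i (fun y => g ‖y‖) x = g' / ‖x‖ * x i := by
  rw [pd, (hasFDerivAt_comp_norm hx hg).fderiv]
  simp [EuclideanSpace.inner_single_right]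

lemma pd_comp_norm_mul_coord {d : ℕ} (i : Fin d) {h : ℝ → ℝ} {h' : ℝ}
    {x : EuclideanSpace ℝ (Fin d)} (hx : x ≠ 0) (hh : HasDerivAt h h' ‖x‖) :
    pd i (fun y => h ‖y‖ * y i) x = h' / ‖x‖ * x i ^ 2 + h ‖x‖ := by
  have hc : HasFDerivAt (fun y : EuclideanSpace ℝ (Fin d) => y i)
      (EuclideanSpace.proj i : EuclideanSpace ℝ (Fin d) →L[ℝ] ℝ) x :=
    (EuclideanSpace.proj i : EuclideanSpace ℝ (Fin d) →L[ℝ] ℝ).hasFDerivAt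
  rw [pd, ((hasFDerivAt_comp_norm hx hh).fun_mul hc).fderiv]
  simp [EuclideanSpace.inner_single_right]
  ring

/-- The Laplacian of a radial function in polar coordinates. -/
lemma sum_pd_pd_comp_norm {d : ℕ} {g g₁ : ℝ → ℝ} {g₂ : ℝ} {x : EuclideanSpace ℝ (Fin d)}
    (hx : x ≠ 0) (hg : ∀ᶠ s in nhds ‖x‖, HasDerivAt g (g₁ s) s) (hg₁ : HasDerivAt g₁ g₂ ‖x‖) :
    ∑ i, pd i (pd i (fun y => g ‖y‖)) x = g₂ + (d - 1) / ‖x‖ * g₁ ‖x‖ := by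
  have hn : ‖x‖ ≠ 0 := norm_ne_zero_iff.2 hx
  have hpd (i : Fin d) : pd i (fun y => g ‖y‖) =ᶠ[nhds x] fun y => g₁ ‖y‖ / ‖y‖ * y i := by
    filter_upwards [continuous_norm.continuousAt.eventually hg, isOpen_ne.mem_nhds hx] with y hy hy0
    exact pd_comp_norm i hy0 hy
  have hterm (i : Fin d) : pd i (pd i (fun y => g ‖y‖)) x =
      (g₂ * ‖x‖ - g₁ ‖x‖) / ‖x‖ ^ 2 / ‖x‖ * x i ^ 2 + g₁ ‖x‖ / ‖x‖ := by
    have hq := pd_comp_norm_mul_coord i hx (by simpa using hg₁.fun_div (hasDerivAt_id' _) hn)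
    rw [pd, (hpd i).fderiv_eq]
    exact hq
  rw [Finset.sum_congr rfl fun i _ => hterm i, Finset.sum_add_distrib, ← Finset.mul_sum,
    ← EuclideanSpace.real_norm_sq_eq]
  simp
  field_simp
  ring

lemma hasDerivAt_weight {a R ε s : ℝ} (hε : 0 < ε) (h1 : ε < s) (h2 : s < R) :
    HasDerivAt (fun s => ((s - ε) * (R - s)) ^ (-a) * (1 + s) ^ a)
      (((s - ε) * (R - s)) ^ (-a) * (1 + s) ^ a *
        (-a / (s - ε) + a / (R - s) + a / (1 + s))) s := by
  have hA : 0 < s - ε := by linarith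
  have hB : 0 < R - s := by linarith
  have hC : 0 < 1 + s := by linarith
  have h := ((((hasDerivAt_id' s).sub_const ε).fun_mul ((hasDerivAt_id' s).const_sub R)).rpow_const
    (p := -a) (Or.inl (by simp; constructor <;> positivity))).fun_mul
    (((hasDerivAt_id' s).const_add 1).rpow_const (p := a) (Or.inl (by simp; positivity)))
  refine h.congr_deriv ?_
  rw [Real.rpow_sub_one (by positivity), Real.rpow_sub_one (by positivity)]
  field_simp
  ring

lemma hasDerivAt_const_mul_rpow_neg_mul {l c k s : ℝ} (hs : 0 < s) :
    HasDerivAt (fun s => c * s ^ (-l) * k) (-l * (c * s ^ (-l) * k) / s) s := by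
  have h := (((hasDerivAt_id' s).rpow_const (p := -l) (Or.inl hs.ne')).const_mul c).mul_const k
  refine h.congr_deriv ?_
  rw [Real.rpow_sub_one hs.ne']
  field_simp

/-- The quotient `Δψ / ψ` in dimension `n`, written with
`X = 1/(r-ε)`, `Y = 1/(R-r)`, `Z = 1/(1+r)`, `W = 1/r` and
`θ = P/(1+P)`, where `P = ε^l r^{-l} R^a`. -/
noncomputable def quotE (a l n θ X Y Z W : ℝ) : ℝ :=
  a * X ^ 2 + a * Y ^ 2 - a * Z ^ 2 + a ^ 2 * (-X + Y + Z) ^ 2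
    - 2 * a * l * θ * W * (-X + Y + Z) + l * (l + 1) * θ * W ^ 2
    + (n - 1) * W * (a * (-X + Y + Z) - l * θ * W)

lemma sum_pd_pd_psiFun {d : ℕ} {p l γ R ε : ℝ} (hε : 0 < ε) (t : ℝ)
    {x : EuclideanSpace ℝ (Fin d)} (h1 : ε < ‖x‖) (h2 : ‖x‖ < R) :
    ∑ i, pd i (pd i (fun y => psiFun p l γ R ε y t)) x =
      psiFun p l γ R ε x t * quotE (2 / (p - 1)) l d
        (ε ^ l * ‖x‖ ^ (-l) * R ^ (2 / (p - 1)) / (1 + ε ^ l * ‖x‖ ^ (-l) * R ^ (2 / (p - 1))))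
        (1 / (‖x‖ - ε)) (1 / (R - ‖x‖)) (1 / (1 + ‖x‖)) (1 / ‖x‖) := by
  have hx0 : 0 < ‖x‖ := hε.trans h1
  have hx : x ≠ 0 := norm_pos_iff.1 hx0
  unfold psiFun
  rw [neg_div]
  set a := 2 / (p - 1)
  set T := Real.exp (γ * (t + 1))
  set A : ℝ → ℝ := fun s => ((s - ε) * (R - s)) ^ (-a) * (1 + s) ^ a with hAdef
  set P : ℝ → ℝ := fun s => ε ^ l * s ^ (-l) * R ^ a with hPdef
  set G : ℝ → ℝ := fun s => -a / (s - ε) + a / (R - s) + a / (1 + s) with hGdef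
  have hA (s : ℝ) (h1 : ε < s) (h2 : s < R) : HasDerivAt A (A s * G s) s :=
    hasDerivAt_weight hε h1 h2
  have hP (s : ℝ) (h : 0 < s) : HasDerivAt P (-l * P s / s) s :=
    hasDerivAt_const_mul_rpow_neg_mul h
  have hG : HasDerivAt G (a / (‖x‖ - ε) ^ 2 + a / (R - ‖x‖) ^ 2 - a / (1 + ‖x‖) ^ 2) ‖x‖ := by
    have hX : ‖x‖ - ε ≠ 0 := by linarith
    have hY : R - ‖x‖ ≠ 0 := by linarith
    have hZ : 1 + ‖x‖ ≠ 0 := by positivity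
    have h := (((hasDerivAt_const ‖x‖ (-a)).fun_div ((hasDerivAt_id' _).sub_const ε) hX).fun_add
      ((hasDerivAt_const ‖x‖ a).fun_div ((hasDerivAt_id' _).const_sub R) hY)).fun_add
      ((hasDerivAt_const ‖x‖ a).fun_div ((hasDerivAt_id' _).const_add 1) hZ)
    refine h.congr_deriv ?_
    ring
  have hg : ∀ᶠ s in nhds ‖x‖, HasDerivAt (fun s => A s * (1 + P s) * T)
      ((A s * G s * (1 + P s) + A s * (-l * P s / s)) * T) s := by
    filter_upwards [Ioo_mem_nhds h1 h2] with s hs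
    exact ((hA s hs.1 hs.2).fun_mul ((hP s (hε.trans hs.1)).const_add 1)).mul_const T
  have hg₁ := ((((hA _ h1 h2).fun_mul hG).fun_mul ((hP _ hx0).const_add 1)).fun_add
    ((hA _ h1 h2).fun_mul (((hP _ hx0).const_mul (-l)).fun_div (hasDerivAt_id' _) hx0.ne'))).mul_const T
  have hmain := sum_pd_pd_comp_norm hx hg hg₁
  have hPpos : 0 < 1 + P ‖x‖ := by
    have hR : 0 < R := hx0.trans h2
    simp only [hPdef]; positivity
  refine hmain.trans ?_
  change _ = A ‖x‖ * (1 + P ‖x‖) * T * quotE a l d (P ‖x‖ / (1 + P ‖x‖)) _ _ _ _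
  simp only [quotE]
  have hGX : G ‖x‖ = a * (-(1 / (‖x‖ - ε)) + 1 / (R - ‖x‖) + 1 / (1 + ‖x‖)) := by
    simp only [hGdef]; ring
  rw [hGX]
  generalize P ‖x‖ = Q at *
  generalize A ‖x‖ = B at *
  obtain ⟨X, hX⟩ : ∃ X, X = 1 / (‖x‖ - ε) := ⟨_, rfl⟩
  obtain ⟨Y, hY⟩ : ∃ Y, Y = 1 / (R - ‖x‖) := ⟨_, rfl⟩
  obtain ⟨Z, hZ⟩ : ∃ Z, Z = 1 / (1 + ‖x‖) := ⟨_, rfl⟩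
  have e1 : a / (‖x‖ - ε) ^ 2 = a * X ^ 2 := by rw [hX, div_pow]; ring
  have e2 : a / (R - ‖x‖) ^ 2 = a * Y ^ 2 := by rw [hY, div_pow]; ring
  have e3 : a / (1 + ‖x‖) ^ 2 = a * Z ^ 2 := by rw [hZ, div_pow]; ring
  rw [e1, e2, e3, ← hX, ← hY, ← hZ]
  field_simp
  ring

lemma deriv_psiFun {d : ℕ} (p l γ R ε : ℝ) (x : EuclideanSpace ℝ (Fin d)) (t : ℝ) :
    deriv (fun s => psiFun p l γ R ε x s) t = γ * psiFun p l γ R ε x t := by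
  unfold psiFun
  have h := (((((hasDerivAt_id' t).add_const 1).const_mul γ).exp).const_mul
    (((‖x‖ - ε) * (R - ‖x‖)) ^ (-2 / (p - 1)) * (1 + ‖x‖) ^ (2 / (p - 1)) *
    (1 + ε ^ l * ‖x‖ ^ (-l) * R ^ (2 / (p - 1))))).deriv
  rw [h]
  ring

lemma psiFun_rpow {d : ℕ} {p l γ R ε : ℝ} (hp : 1 < p) (hε : 0 < ε) (t : ℝ)
    {x : EuclideanSpace ℝ (Fin d)} (h1 : ε < ‖x‖) (h2 : ‖x‖ < R) :
    psiFun p l γ R ε x t ^ p = psiFun p l γ R ε x t *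
      ((1 / (‖x‖ - ε) * (1 / (R - ‖x‖)) * (1 + ‖x‖)) ^ 2 *
        (1 + ε ^ l * ‖x‖ ^ (-l) * R ^ (2 / (p - 1))) ^ (p - 1) *
        Real.exp (γ * (t + 1) * (p - 1))) := by
  have hx0 : 0 < ‖x‖ := hε.trans h1
  have hR : 0 < R := hx0.trans h2
  have hX : 0 < ‖x‖ - ε := by linarith
  have hY : 0 < R - ‖x‖ := by linarith
  have hp' : p - 1 ≠ 0 := by linarith
  have hpos : 0 < psiFun p l γ R ε x t := by unfold psiFun; positivity
  have hsplit : psiFun p l γ R ε x t ^ p =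
      psiFun p l γ R ε x t * psiFun p l γ R ε x t ^ (p - 1) := by
    rw [Real.rpow_sub_one hpos.ne']; field_simp
  rw [hsplit]
  congr 1
  unfold psiFun
  rw [Real.mul_rpow (by positivity) (by positivity), Real.mul_rpow (by positivity) (by positivity),
    Real.mul_rpow (by positivity) (by positivity), ← Real.rpow_mul (by positivity),
    ← Real.rpow_mul (by positivity), ← Real.exp_mul, div_mul_cancel₀ _ hp', div_mul_cancel₀ _ hp',
    Real.rpow_neg (by positivity), Real.rpow_two, Real.rpow_two]
  congr 2
  field_simp

lemma quotE_le {a l n θ X Y Z W : ℝ} (ha : 0 < a) (hl : 0 < l) (hl1 : l ≤ 1) (hn : 1 ≤ n)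
    (hθ : 0 ≤ θ) (hθ1 : θ ≤ 1) (hY : 0 ≤ Y) (hZ : 0 ≤ Z) (hW : 0 ≤ W) (hWX : W ≤ X) :
    quotE a l n θ X Y Z W ≤ a * (a + 1) * X ^ 2 - (n - 1) * a * W ^ 2 + 2 * a * l * W * X
      + 2 * l * W ^ 2 + (a * Y ^ 2 + a ^ 2 * (Y + Z) ^ 2 + (n - 1) * a * W * (Y + Z)) := by
  have hX : 0 ≤ X := hW.trans hWX
  have hn' : 0 ≤ n - 1 := by linarith
  have hθ' : 0 ≤ 1 - θ := by linarith
  have t1 : 0 ≤ 2 * a ^ 2 * X * (Y + Z) := by positivity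
  have t2 : 0 ≤ 2 * a * l * θ * W * (Y + Z) := by positivity
  have t3 : 0 ≤ 2 * a * l * W * X * (1 - θ) := by positivity
  have t4 : 0 ≤ (n - 1) * W * (l * θ * W) := by positivity
  have t5 : 0 ≤ (n - 1) * a * W * (X - W) := mul_nonneg (by positivity) (by linarith)
  have t6 : 0 ≤ a * Z ^ 2 := by positivity
  have t7 : l * (l + 1) * θ * W ^ 2 ≤ 2 * l * W ^ 2 := by
    have : (l + 1) * θ ≤ 2 := by nlinarith
    have := mul_le_mul_of_nonneg_left this (by positivity : 0 ≤ l * W ^ 2)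
    linarith
  unfold quotE
  linarith

lemma quotE_le_sq {a l n θ X Y Z W : ℝ} (ha : 0 < a) (hl : 0 < l) (hl1 : l ≤ 1) (hn : 1 ≤ n)
    (hθ : 0 ≤ θ) (hθ1 : θ ≤ 1) (hY : 0 ≤ Y) (hZ : 0 ≤ Z) (hW : 0 ≤ W) (hWX : W ≤ X) :
    quotE a l n θ X Y Z W ≤
      (3 * a ^ 2 + 4 * a + 2 + (n - 1) * a) * (X ^ 2 + Y ^ 2 + Z ^ 2) := by
  have hX : 0 ≤ X := hW.trans hWX
  have hn' : 0 ≤ n - 1 := by linarith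
  have hW2 : W ^ 2 ≤ X ^ 2 := by gcongr
  have t1 : 2 * a * l * W * X ≤ 2 * a * X ^ 2 := by
    have : l * (W * X) ≤ 1 * (X * X) := by gcongr
    nlinarith
  have t2 : 2 * l * W ^ 2 ≤ 2 * X ^ 2 := by
    have : l * W ^ 2 ≤ 1 * X ^ 2 := by gcongr
    linarith
  have t3 : a ^ 2 * (Y + Z) ^ 2 ≤ a ^ 2 * (2 * (Y ^ 2 + Z ^ 2)) := by
    gcongr; nlinarith [sq_nonneg (Y - Z)]
  have t4 : (n - 1) * a * W * (Y + Z) ≤ (n - 1) * a * (X ^ 2 + Y ^ 2 + Z ^ 2) := by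
    rw [mul_assoc _ W]
    gcongr
    nlinarith [sq_nonneg (Y - W), sq_nonneg (Z - W), sq_nonneg Y, sq_nonneg Z]
  have t5 : 0 ≤ (n - 1) * a * W ^ 2 := by positivity
  have t6 : 0 ≤ a ^ 2 * X ^ 2 := by positivity
  have t7 : 0 ≤ a ^ 2 * Y ^ 2 := by positivity
  have t8 : 0 ≤ a ^ 2 * Z ^ 2 := by positivity
  have t9 : 0 ≤ a * X ^ 2 := by positivity
  have t10 : 0 ≤ a * Y ^ 2 := by positivity
  have t11 : 0 ≤ a * Z ^ 2 := by positivity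
  have := quotE_le ha hl hl1 hn hθ hθ1 hY hZ hW hWX
  nlinarith [sq_nonneg Y, sq_nonneg Z]

lemma quotE_le_of_le {a l n θ X Y Z W δ : ℝ} (ha : 0 < a) (hl : 0 < l) (hl1 : l ≤ 1) (hn : 1 ≤ n)
    (hθ : 0 ≤ θ) (hθ1 : θ ≤ 1) (hY : 0 ≤ Y) (hZ : 0 ≤ Z) (hW : 0 ≤ W) (hWX : W ≤ X)
    (hY1 : Y ≤ 1) (hZ1 : Z ≤ 1) (hδ : 0 < δ) (hδ1 : δ ≤ 1) (hXW : X ≤ (1 + δ) * W) :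
    quotE a l n θ X Y Z W ≤
      (a * (a + 2 - n) + 3 * a * (a + 1) * δ + (4 * a + 2) * l) * W ^ 2
        + (a + 4 * a ^ 2) + 2 * (n - 1) * a * W := by
  have hX : 0 ≤ X := hW.trans hWX
  have hn' : 0 ≤ n - 1 := by linarith
  have t1 : a * (a + 1) * X ^ 2 ≤ a * (a + 1) * ((1 + 3 * δ) * W ^ 2) := by
    have : X ^ 2 ≤ ((1 + δ) * W) ^ 2 := by gcongr
    have h3 : (1 + δ) ^ 2 ≤ 1 + 3 * δ := by nlinarith
    have := mul_le_mul_of_nonneg_right h3 (sq_nonneg W)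
    gcongr
    linarith
  have t2 : 2 * a * l * W * X ≤ 2 * a * l * W * (2 * W) := by
    gcongr
    nlinarith
  have t3 : a * Y ^ 2 ≤ a * 1 := by gcongr; nlinarith
  have t4 : a ^ 2 * (Y + Z) ^ 2 ≤ a ^ 2 * 4 := by gcongr; nlinarith
  have t5 : (n - 1) * a * W * (Y + Z) ≤ (n - 1) * a * W * 2 := by gcongr; linarith
  have := quotE_le ha hl hl1 hn hθ hθ1 hY hZ hW hWX
  linarith

lemma exists_quotE_bound {p a n c M r₀ : ℝ} (hp : 1 < p) (ha : a = 2 / (p - 1)) (hn : 1 ≤ n)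
    (hc : c < -(a * (a + 2 - n)) / 2) (hr₀ : 0 < r₀) (hr₁ : r₀ ≤ 1) :
    ∃ l γ : ℝ, 0 < l ∧ l ≤ 1 ∧ 0 < γ ∧ ∀ R ε s b t θ : ℝ, 2 ≤ R → 0 < ε → ε ≤ r₀ / 2 → ε < s →
      s < R → b ≤ M → (s ≤ r₀ → s ^ 2 * b ≤ c) → 0 < t → 0 ≤ θ → θ ≤ 1 →
      1 / 2 * quotE a l n θ (1 / (s - ε)) (1 / (R - s)) (1 / (1 + s)) (1 / s) + b
        - (1 / (s - ε) * (1 / (R - s)) * (1 + s)) ^ 2 *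
            (1 + ε ^ l * s ^ (-l) * R ^ a) ^ (p - 1) * Real.exp (γ * (t + 1) * (p - 1))
        - γ ≤ 0 := by
  have hp' : 0 < p - 1 := by linarith
  have ha0 : 0 < a := by rw [ha]; positivity
  have hn' : 0 ≤ n - 1 := by linarith
  obtain ⟨κ, hκ⟩ : ∃ κ, κ = -(a * (a + 2 - n)) / 2 - c := ⟨_, rfl⟩
  have hκ0 : 0 < κ := by linarith
  obtain ⟨δ, hδ0, hδ1, hδ⟩ : ∃ δ : ℝ, 0 < δ ∧ δ ≤ 1 ∧ 3 * a * (a + 1) * δ ≤ κ / 2 := by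
    refine ⟨min 1 (κ / 2 / (3 * a * (a + 1))), by positivity, min_le_left _ _, ?_⟩
    rw [← le_div_iff₀' (by positivity)]
    exact min_le_right _ _
  obtain ⟨l, hl0, hl1, hl⟩ : ∃ l : ℝ, 0 < l ∧ l ≤ 1 ∧ (4 * a + 2) * l ≤ κ / 2 := by
    refine ⟨min 1 (κ / 2 / (4 * a + 2)), by positivity, min_le_left _ _, ?_⟩
    rw [← le_div_iff₀' (by positivity)]
    exact min_le_right _ _
  obtain ⟨q, hq⟩ : ∃ q, q = δ / (1 + δ) := ⟨_, rfl⟩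
  have hq0 : 0 < q := by rw [hq]; positivity
  have hq1 : q ≤ 1 := by rw [hq, div_le_one (by positivity)]; linarith
  obtain ⟨N, hN⟩ : ∃ N, N = 3 * a ^ 2 + 4 * a + 2 + (n - 1) * a := ⟨_, rfl⟩
  have hN0 : 0 < N := by rw [hN]; positivity
  obtain ⟨γ, hγ⟩ : ∃ γ, γ = |M| + (a + 4 * a ^ 2) / 2 + ((n - 1) * a) ^ 2 / (2 * κ)
    + N * ((2 / r₀) ^ 2 + 1) + 2 * N / ((p - 1) * q ^ (p - 1)) := ⟨_, rfl⟩
  have g1 : 0 ≤ |M| := abs_nonneg M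
  have g2 : 0 ≤ (a + 4 * a ^ 2) / 2 := by positivity
  have g3 : 0 ≤ ((n - 1) * a) ^ 2 / (2 * κ) := by positivity
  have g4 : 0 < N * ((2 / r₀) ^ 2 + 1) := by positivity
  have g5 : 0 < 2 * N / ((p - 1) * q ^ (p - 1)) := by positivity
  have hγ0 : 0 < γ := by linarith
  have hγfar : |M| + N * ((2 / r₀) ^ 2 + 1) ≤ γ := by linarith
  have hγmid : (a + 4 * a ^ 2) / 2 + ((n - 1) * a) ^ 2 / (2 * κ) ≤ γ := by linarith
  have hγq : 2 * N ≤ γ * (p - 1) * q ^ (p - 1) := by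
    have : 2 * N / ((p - 1) * q ^ (p - 1)) ≤ γ := by linarith
    rw [div_le_iff₀ (by positivity)] at this
    linarith
  clear hγ
  have hqp : q ^ (p - 1) ≤ 1 := Real.rpow_le_one hq0.le hq1 hp'.le
  have hγN : 2 * N ≤ γ * (p - 1) := by
    refine hγq.trans (mul_le_of_le_one_right (by positivity) hqp)
  refine ⟨l, γ, hl0, hl1, hγ0, ?_⟩
  intro R ε s b t θ hR hε hεr hεs hsR hbM hbc ht hθ hθ1
  have hs : 0 < s := hε.trans hεs
  have hR0 : 0 < R := hs.trans hsR
  have hbM' : b ≤ |M| := hbM.trans (le_abs_self M)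
  have hsε : 0 < s - ε := by linarith
  have hRs : 0 < R - s := by linarith
  obtain ⟨X, hX⟩ : ∃ X, X = 1 / (s - ε) := ⟨_, rfl⟩
  obtain ⟨Y, hY⟩ : ∃ Y, Y = 1 / (R - s) := ⟨_, rfl⟩
  obtain ⟨Z, hZ⟩ : ∃ Z, Z = 1 / (1 + s) := ⟨_, rfl⟩
  obtain ⟨W, hW⟩ : ∃ W, W = 1 / s := ⟨_, rfl⟩
  have hX0 : 0 < X := by rw [hX]; positivity
  have hY0 : 0 < Y := by rw [hY]; positivity
  have hZ0 : 0 < Z := by rw [hZ]; positivity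
  have hW0 : 0 < W := by rw [hW]; positivity
  have hWX : W ≤ X := by rw [hX, hW]; gcongr; linarith
  have hZ1 : Z ≤ 1 := by rw [hZ, div_le_one (by positivity)]; linarith
  have hexp : γ * (p - 1) ≤ Real.exp (γ * (t + 1) * (p - 1)) := by
    have h1 := Real.add_one_le_exp (γ * (t + 1) * (p - 1))
    have h2 : 0 ≤ γ * t * (p - 1) := by positivity
    linarith
  have hB1 : 1 ≤ (1 + ε ^ l * s ^ (-l) * R ^ a) ^ (p - 1) :=
    Real.one_le_rpow (le_add_of_nonneg_right (by positivity)) hp'.le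
  rw [← hX, ← hY, ← hZ, ← hW]
  have hcrude := quotE_le_sq ha0 hl0 hl1 hn hθ hθ1 hY0.le hZ0.le hW0.le hWX
  rw [← hN] at hcrude
  rcases le_or_gt s r₀ with hsr | hsr
  · have hs1 : s ≤ 1 := hsr.trans hr₁
    have hY1 : Y ≤ 1 := by rw [hY, div_le_one hRs]; linarith
    rcases le_or_gt ε (q * s) with hεq | hεq
    · have hXW : X ≤ (1 + δ) * W := by
        rw [hX, hW, mul_one_div, div_le_div_iff₀ hsε hs]
        have : ε * (1 + δ) ≤ δ * s := by
          calc ε * (1 + δ) ≤ q * s * (1 + δ) := by gcongr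
            _ = δ * s := by rw [hq]; field_simp
        linarith
      have hE := quotE_le_of_le ha0 hl0 hl1 hn hθ hθ1 hY0.le hZ0.le hW0.le hWX hY1 hZ1 hδ0 hδ1 hXW
      have hb : b ≤ c * W ^ 2 := by
        rw [hW, div_pow, one_pow, mul_one_div, le_div_iff₀ (by positivity)]
        linarith [hbc hsr]
      have hsq : (n - 1) * a * W ≤ κ / 2 * W ^ 2 + ((n - 1) * a) ^ 2 / (2 * κ) := by
        have : κ / 2 * W ^ 2 + ((n - 1) * a) ^ 2 / (2 * κ) - (n - 1) * a * W
            = (κ * W - (n - 1) * a) ^ 2 / (2 * κ) := by field_simp; ring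
        have h0 : 0 ≤ (κ * W - (n - 1) * a) ^ 2 / (2 * κ) := by positivity
        linarith
      have hcoef : (3 * a * (a + 1) * δ + (4 * a + 2) * l) * W ^ 2 ≤ κ * W ^ 2 := by
        gcongr; linarith
      have hF : 0 ≤ (X * Y * (1 + s)) ^ 2 * (1 + ε ^ l * s ^ (-l) * R ^ a) ^ (p - 1) *
          Real.exp (γ * (t + 1) * (p - 1)) := by positivity
      have hκW : κ * W ^ 2 = -(a * (a + 2 - n)) / 2 * W ^ 2 - c * W ^ 2 := by rw [hκ]; ring
      linarith
    · have hX1 : 1 ≤ X := by rw [hX, le_div_iff₀ hsε]; linarith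
      have hRY : 1 ≤ R * Y := by rw [hY, mul_one_div, le_div_iff₀ hRs]; linarith
      have hB : q ^ (p - 1) * R ^ 2 ≤ (1 + ε ^ l * s ^ (-l) * R ^ a) ^ (p - 1) := by
        have h1 : q ≤ ε ^ l * s ^ (-l) := by
          calc q = q ^ (1 : ℝ) := (Real.rpow_one q).symm
            _ ≤ q ^ l := Real.rpow_le_rpow_of_exponent_ge hq0 hq1 hl1
            _ ≤ (ε / s) ^ l := by
              gcongr
              rw [le_div_iff₀ hs]; exact hεq.le
            _ = ε ^ l * s ^ (-l) := by
              rw [Real.div_rpow hε.le hs.le, Real.rpow_neg hs.le, div_eq_mul_inv]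
        calc q ^ (p - 1) * R ^ 2 = (q * R ^ a) ^ (p - 1) := by
              rw [Real.mul_rpow hq0.le (by positivity), ← Real.rpow_mul hR0.le, ha,
                div_mul_cancel₀ _ hp'.ne', Real.rpow_two]
          _ ≤ (ε ^ l * s ^ (-l) * R ^ a) ^ (p - 1) := by gcongr
          _ ≤ _ := by gcongr; linarith
      have hF : X ^ 2 * q ^ (p - 1) * (γ * (p - 1)) ≤
          (X * Y * (1 + s)) ^ 2 * (1 + ε ^ l * s ^ (-l) * R ^ a) ^ (p - 1) *
          Real.exp (γ * (t + 1) * (p - 1)) := by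
        refine mul_le_mul ?_ hexp (by positivity) (by positivity)
        calc X ^ 2 * q ^ (p - 1) = X ^ 2 * q ^ (p - 1) * (1 * 1) ^ 2 := by ring
          _ ≤ X ^ 2 * q ^ (p - 1) * (R * Y * (1 + s)) ^ 2 := by gcongr; linarith
          _ = (X * Y * (1 + s)) ^ 2 * (q ^ (p - 1) * R ^ 2) := by ring
          _ ≤ _ := mul_le_mul_of_nonneg_left hB (sq_nonneg _)
      have h3 : N * (X ^ 2 + Y ^ 2 + Z ^ 2) ≤ N * (3 * X ^ 2) := by
        have : Y ^ 2 ≤ X ^ 2 := by gcongr; linarith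
        have : Z ^ 2 ≤ X ^ 2 := by gcongr; linarith
        gcongr
        linarith
      have h4 : X ^ 2 * (2 * N) ≤ X ^ 2 * (γ * (p - 1) * q ^ (p - 1)) := by gcongr
      have h5 : 0 ≤ N * X ^ 2 := by positivity
      linarith
  · have hXD : X ^ 2 ≤ (2 / r₀) ^ 2 := by
      gcongr
      rw [hX, div_le_div_iff₀ hsε hr₀]
      linarith
    have hF : Y ^ 2 * 1 * (γ * (p - 1)) ≤
        (X * Y * (1 + s)) ^ 2 * (1 + ε ^ l * s ^ (-l) * R ^ a) ^ (p - 1) *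
        Real.exp (γ * (t + 1) * (p - 1)) := by
      have h1 : 1 ≤ X * (1 + s) := by rw [hX, one_div_mul_eq_div, le_div_iff₀ hsε]; linarith
      have h2 : Y ≤ X * Y * (1 + s) := by
        have := mul_le_mul_of_nonneg_right h1 hY0.le
        linarith
      gcongr
    have h3 : N * (X ^ 2 + Y ^ 2 + Z ^ 2) ≤ N * ((2 / r₀) ^ 2 + Y ^ 2 + 1) := by
      have : Z ^ 2 ≤ 1 := pow_le_one₀ hZ0.le hZ1
      gcongr
    have h4 : Y ^ 2 * (2 * N) ≤ Y ^ 2 * (γ * (p - 1)) := by gcongr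
    have h5 : 0 ≤ N * Y ^ 2 := by positivity
    linarith

/-- under the hypotheses of Theorem 4 part (2), for suitable
`l ∈ (0,1]`, `γ > 0`, and all sufficiently large `R` and small `ε`, the function
`ψ_{R,ε}` is a supersolution:
`(1/2)Δψ + βψ − ψ^p − ψ_t ≤ 0` on `{ε < |x| < R} × (0,∞)`. -/
theorem stmt_19 {d : ℕ} (hd : 2 ≤ d) (p : ℝ) (hp : 1 < p)
    (hdim : (d : ℝ) < 2 * p / (p - 1))
    (β₀ : ℝ) (hβ₀ : β₀ = ((d : ℝ) * (p - 1) - 2 * p) / (p - 1) ^ 2)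
    (β : EuclideanSpace ℝ (Fin d) → ℝ)
    (hβ_cont : ContinuousOn β ({0}ᶜ : Set (EuclideanSpace ℝ (Fin d))))
    (hβ_bdd : ∃ M : ℝ, ∀ x : EuclideanSpace ℝ (Fin d), x ≠ 0 → β x ≤ M)
    (hβ_limsup : ∃ c : ℝ, c < β₀ ∧ ∃ r : ℝ, 0 < r ∧
      ∀ x : EuclideanSpace ℝ (Fin d), x ≠ 0 → ‖x‖ ≤ r → ‖x‖ ^ 2 * β x ≤ c) :
    ∃ l γ R₀ ε₀ : ℝ, 0 < l ∧ l ≤ 1 ∧ 0 < γ ∧ 1 < R₀ ∧ 0 < ε₀ ∧ ε₀ < 1 ∧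
      ∀ R : ℝ, R₀ ≤ R → ∀ ε : ℝ, 0 < ε → ε ≤ ε₀ →
        ∀ (x : EuclideanSpace ℝ (Fin d)) (t : ℝ), ε < ‖x‖ → ‖x‖ < R → 0 < t →
          (1 / 2) * (∑ i, pd i (pd i (fun y => psiFun p l γ R ε y t)) x)
              + β x * psiFun p l γ R ε x t
              - psiFun p l γ R ε x t ^ p
              - deriv (fun s => psiFun p l γ R ε x s) t ≤ 0 := by
  have hp' : 0 < p - 1 := by linarith
  obtain ⟨M, hM⟩ := hβ_bdd
  obtain ⟨c, hc, r, hr, hβr⟩ := hβ_limsup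
  have hn : (1 : ℝ) ≤ d := by exact_mod_cast (by omega : 1 ≤ d)
  have hc' : c < -(2 / (p - 1) * (2 / (p - 1) + 2 - d)) / 2 := by
    refine hc.trans_eq ?_
    rw [hβ₀]
    field_simp
    ring
  obtain ⟨l, γ, hl0, hl1, hγ, H⟩ := exists_quotE_bound (M := M) hp rfl hn hc'
    (lt_min hr one_pos) (min_le_right r 1)
  have hmin : min r 1 ≤ 1 := min_le_right r 1
  refine ⟨l, γ, 2, min r 1 / 2, hl0, hl1, hγ, by norm_num, by positivity, by linarith, ?_⟩
  intro R hR ε hε hεr x t h1 h2 ht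
  have hx0 : 0 < ‖x‖ := hε.trans h1
  have hx : x ≠ 0 := norm_pos_iff.1 hx0
  have hR0 : 0 < R := hx0.trans h2
  have hX : 0 < ‖x‖ - ε := by linarith
  have hY : 0 < R - ‖x‖ := by linarith
  have hψ : 0 ≤ psiFun p l γ R ε x t := by unfold psiFun; positivity
  have hP : 0 < ε ^ l * ‖x‖ ^ (-l) * R ^ (2 / (p - 1)) := by positivity
  have key := H R ε ‖x‖ (β x) t
    (ε ^ l * ‖x‖ ^ (-l) * R ^ (2 / (p - 1)) / (1 + ε ^ l * ‖x‖ ^ (-l) * R ^ (2 / (p - 1))))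
    hR hε hεr h1 h2 (hM x hx) (fun h => hβr x hx (h.trans (min_le_left r 1))) ht (by positivity)
    (by rw [div_le_one (by positivity)]; linarith)
  rw [sum_pd_pd_psiFun hε t h1 h2, psiFun_rpow hp hε t h1 h2, deriv_psiFun]
  have := mul_nonpos_of_nonneg_of_nonpos hψ key
  linarith
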